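/- Let x be a complex number and α a complex number such that neither 2α nor α+1/2 is a nonpositive integer. Then (₁F₁(α; 2α; x))² = e^x · ₁F₂(α; α+1/2, 2α; x²/4). -/

import Mathlib

/-- Pochhammer symbol (rising factorial) `(c)_k = c (c+1) ⋯ (c+k-1)` for complex `c`. -/
noncomputable def poch (c : ℂ) (k : ℕ) : ℂ := ∏ l ∈ Finset.range k, (c + l)

/-- Generalized hypergeometric series `ₚF_q(a; b; x) = Σ_k (a₁)_k⋯(a_p)_k / ((b₁)_k⋯(b_q)_k) · x^k/k!`. -/
noncomputable def pFq (a b : List ℂ) (x : ℂ) : ℂ :=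
  ∑' k : ℕ, ((a.map (fun c => poch c k)).prod / (b.map (fun c => poch c k)).prod)
    * x ^ k / (Nat.factorial k)

/-- `c` is not a nonpositive integer, i.e. `c ≠ 0, -1, -2, …`. -/
def NotNonposInt (c : ℂ) : Prop := ∀ n : ℕ, c ≠ -(n : ℂ)

namespace PowerSeries

open Finset

theorem coeff_X_mul_derivative {R : Type*} [CommSemiring R] (f : PowerSeries R) (n : ℕ) :
    coeff n (X * derivative R f) = n * coeff n f := by
  cases n with
  | zero => simp
  | succ n => rw [coeff_succ_X_mul, coeff_derivative]; push_cast; ring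

theorem derivative_rescale_exp (c : ℂ) :
    derivative ℂ (rescale c (exp ℂ)) = C c * rescale c (exp ℂ) := by
  ext n
  rw [coeff_derivative, coeff_C_mul, coeff_rescale, coeff_rescale, coeff_exp, coeff_exp,
    Nat.factorial_succ]
  have h : (n : ℂ) + 1 ≠ 0 := Nat.cast_add_one_ne_zero n
  have h' : (n.factorial : ℂ) ≠ 0 := Nat.cast_ne_zero.mpr n.factorial_ne_zero
  simp only [eq_ratCast]
  push_cast
  field_simp
  ring

theorem tsum_coeff_mul_pow {f g : PowerSeries ℂ} {x : ℂ}
    (hf : Summable fun n => ‖coeff n f * x ^ n‖) (hg : Summable fun n => ‖coeff n g * x ^ n‖) :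
    (Summable fun n => ‖coeff n (f * g) * x ^ n‖) ∧
      ∑' n, coeff n (f * g) * x ^ n = (∑' n, coeff n f * x ^ n) * ∑' n, coeff n g * x ^ n := by
  have key : ∀ n, coeff n (f * g) * x ^ n =
      ∑ kl ∈ antidiagonal n, (coeff kl.1 f * x ^ kl.1) * (coeff kl.2 g * x ^ kl.2) := by
    intro n
    rw [coeff_mul, sum_mul]
    refine sum_congr rfl fun kl hkl => ?_
    rw [← mem_antidiagonal.mp hkl, pow_add]
    ring
  simp only [key]
  exact ⟨summable_norm_sum_mul_antidiagonal_of_summable_norm (f := fun n => coeff n f * x ^ n)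
      (g := fun n => coeff n g * x ^ n) hf hg,
    (tsum_mul_tsum_eq_tsum_sum_antidiagonal_of_summable_norm (f := fun n => coeff n f * x ^ n)
      (g := fun n => coeff n g * x ^ n) hf hg).symm⟩

theorem coeff_rescale_exp_mul_pow (c x : ℂ) (n : ℕ) :
    coeff n (rescale c (exp ℂ)) * x ^ n = (c * x) ^ n / n.factorial := by
  rw [coeff_rescale, coeff_exp]
  simp only [eq_ratCast]
  push_cast
  ring

theorem summable_norm_rescale_exp (c x : ℂ) :
    Summable fun n => ‖coeff n (rescale c (exp ℂ)) * x ^ n‖ := by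
  simpa only [coeff_rescale_exp_mul_pow] using NormedSpace.norm_expSeries_div_summable (c * x)

theorem tsum_rescale_exp (c x : ℂ) :
    ∑' n, coeff n (rescale c (exp ℂ)) * x ^ n = Complex.exp (c * x) := by
  simp only [coeff_rescale_exp_mul_pow, Complex.exp_eq_exp_ℂ, NormedSpace.exp_eq_tsum_div]

/-- If `F` solves Kummer's equation with parameters `α, 2α`, then `e^{-X/2} F` solves a
Bessel-type equation. -/
theorem bessel_of_kummer {α : ℂ} {F : PowerSeries ℂ}
    (hF : X * derivative ℂ (derivative ℂ F) + C (2 * α) * derivative ℂ F =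
      X * derivative ℂ F + C α * F) :
    X * derivative ℂ (derivative ℂ (rescale (-1 / 2) (exp ℂ) * F)) +
      C (2 * α) * derivative ℂ (rescale (-1 / 2) (exp ℂ) * F) =
      C (1 / 4) * (X * (rescale (-1 / 2) (exp ℂ) * F)) := by
  have hD := derivative_rescale_exp (-1 / 2)
  set D := rescale (-1 / 2 : ℂ) (exp ℂ)
  have e1 : (C (1 / 4) : PowerSeries ℂ) = C (-1 / 2) * C (-1 / 2) := by
    rw [← map_mul]; norm_num
  have e2 : 2 * (C (-1 / 2) : PowerSeries ℂ) = -1 := by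
    rw [← map_ofNat (C (R := ℂ)) 2, ← map_mul]; norm_num
  have e3 : (C (2 * α) : PowerSeries ℂ) = 2 * C α := by
    rw [map_mul, map_ofNat]
  simp only [Derivation.leibniz, map_add, smul_eq_mul, hD, derivative_C, e1, e3] at hF ⊢
  linear_combination D * hF + (X * D * derivative ℂ F + C α * D * F) * e2

/-- The square of a solution of a Bessel-type equation solves a third-order equation. -/
theorem sq_of_bessel {α : ℂ} {W : PowerSeries ℂ}
    (hW : X * derivative ℂ (derivative ℂ W) + C (2 * α) * derivative ℂ W = C (1 / 4) * (X * W)) :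
    X * derivative ℂ (X * derivative ℂ (derivative ℂ (W * W)) +
        C (2 * α) * derivative ℂ (W * W) - C (1 / 2) * (X * (W * W))) =
      C (1 - 4 * α) * (X * derivative ℂ (derivative ℂ (W * W)) +
        C (2 * α) * derivative ℂ (W * W) - C (1 / 2) * (X * (W * W))) +
      C (1 / 2) * (X * (X * derivative ℂ (W * W))) := by
  have e1 : (C (1 / 2) : PowerSeries ℂ) = 2 * C (1 / 4) := by
    rw [← map_ofNat (C (R := ℂ)) 2, ← map_mul]; norm_num
  have e3 : (C (2 * α) : PowerSeries ℂ) = 2 * C α := by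
    rw [map_mul, map_ofNat]
  have e4 : (C (1 - 4 * α) : PowerSeries ℂ) = 1 - 4 * C α := by
    rw [map_sub, map_mul, map_ofNat, map_one]
  rw [e3] at hW
  have hu : X * derivative ℂ (derivative ℂ (W * W)) +
        C (2 * α) * derivative ℂ (W * W) - C (1 / 2) * (X * (W * W)) =
      X * (derivative ℂ W * derivative ℂ W) + X * (derivative ℂ W * derivative ℂ W) := by
    simp only [Derivation.leibniz, map_add, smul_eq_mul, e1, e3]
    linear_combination 2 * W * hW
  rw [hu]
  simp only [Derivation.leibniz, map_add, smul_eq_mul, e1, e4, derivative_X]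
  linear_combination 4 * X * derivative ℂ W * hW

theorem coeff_odd_of_bessel {α : ℂ} (hα : NotNonposInt (2 * α)) {W : PowerSeries ℂ}
    (hW : X * derivative ℂ (derivative ℂ W) + C (2 * α) * derivative ℂ W = C (1 / 4) * (X * W))
    (m : ℕ) : coeff (2 * m + 1) W = 0 := by
  have hc := fun n => congrArg (coeff n) hW
  simp only [map_add, coeff_C_mul, coeff_X_mul_derivative, coeff_derivative] at hc
  have hne : ∀ n : ℕ, (n : ℂ) + 2 * α ≠ 0 := fun n h => hα n (by linear_combination h)
  have hne' : ∀ n : ℕ, (n : ℂ) + 1 ≠ 0 := Nat.cast_add_one_ne_zero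
  induction m with
  | zero =>
    have h := hc 0
    have h0 := hne 0
    simp only [coeff_zero_X_mul] at h
    refine (mul_eq_zero.mp (?_ : (((0 : ℕ) : ℂ) + 2 * α) * _ = 0)).resolve_left h0
    push_cast at h ⊢
    linear_combination h
  | succ m ih =>
    have h := hc (2 * m + 1 + 1)
    rw [coeff_succ_X_mul, ih] at h
    refine (mul_eq_zero.mp (?_ : ((((2 * m + 1 + 1 : ℕ) : ℂ) + 2 * α) *
      (((2 * m + 1 + 1 : ℕ) : ℂ) + 1)) * _ = 0)).resolve_left
      (mul_ne_zero (hne _) (hne' _))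
    rw [show 2 * (m + 1) + 1 = 2 * m + 1 + 1 + 1 by ring]
    linear_combination h

theorem coeff_odd_mul_self {R : Type*} [CommSemiring R] {W : PowerSeries R}
    (hW : ∀ m, coeff (2 * m + 1) W = 0) (m : ℕ) : coeff (2 * m + 1) (W * W) = 0 := by
  rw [coeff_mul]
  refine sum_eq_zero fun kl hkl => ?_
  have h := mem_antidiagonal.mp hkl
  rcases Nat.even_or_odd' kl.1 with ⟨j, hj | hj⟩
  · rw [show kl.2 = 2 * (m - j) + 1 by omega, hW, mul_zero]
  · rw [hj, hW, zero_mul]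

theorem coeff_even_succ_sq_of_bessel {α : ℂ} {W : PowerSeries ℂ}
    (hW : X * derivative ℂ (derivative ℂ W) + C (2 * α) * derivative ℂ W = C (1 / 4) * (X * W))
    (m : ℕ) : 4 * ((m + 2 * α) * (m + 1) * (m + (α + 1 / 2))) * coeff (2 * (m + 1)) (W * W) =
      (m + α) * coeff (2 * m) (W * W) := by
  have h := congrArg (coeff (2 * m + 1)) (sq_of_bessel hW)
  simp only [map_add, map_sub (coeff (2 * m + 1)), coeff_C_mul, coeff_X_mul_derivative,
    coeff_derivative, coeff_succ_X_mul] at h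
  rw [show 2 * (m + 1) = 2 * m + 1 + 1 by ring]
  push_cast at h
  linear_combination h / 2

end PowerSeries

open PowerSeries

theorem poch_zero (c : ℂ) : poch c 0 = 1 := Finset.prod_range_zero _

theorem poch_succ (c : ℂ) (k : ℕ) : poch c (k + 1) = poch c k * (c + k) :=
  Finset.prod_range_succ _ _

theorem NotNonposInt.add_ne_zero {c : ℂ} (hc : NotNonposInt c) (n : ℕ) : c + n ≠ 0 :=
  fun h => hc n (eq_neg_of_add_eq_zero_left h)

theorem poch_ne_zero {c : ℂ} (hc : NotNonposInt c) (k : ℕ) : poch c k ≠ 0 :=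
  Finset.prod_ne_zero_iff.mpr fun n _ => hc.add_ne_zero n

/-- The formal power series `₁F₁(a; b; X)`. -/
noncomputable def kummerSeries (a b : ℂ) : PowerSeries ℂ :=
  PowerSeries.mk fun k => poch a k / poch b k / k.factorial

theorem coeff_kummerSeries_succ (a : ℂ) {b : ℂ} (hb : NotNonposInt b) (n : ℕ) :
    coeff (n + 1) (kummerSeries a b) =
      (a + n) / ((b + n) * (n + 1)) * coeff n (kummerSeries a b) := by
  have h1 : (n : ℂ) + 1 ≠ 0 := Nat.cast_add_one_ne_zero n
  have h2 : (n.factorial : ℂ) ≠ 0 := Nat.cast_ne_zero.mpr n.factorial_ne_zero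
  have h3 := hb.add_ne_zero n
  have h4 := poch_ne_zero hb n
  simp only [kummerSeries, coeff_mk, poch_succ, Nat.factorial_succ]
  push_cast
  field_simp

theorem kummerSeries_ode (a : ℂ) {b : ℂ} (hb : NotNonposInt b) :
    X * derivative ℂ (derivative ℂ (kummerSeries a b)) + C b * derivative ℂ (kummerSeries a b) =
      X * derivative ℂ (kummerSeries a b) + C a * kummerSeries a b := by
  ext n
  have h1 : (n : ℂ) + 1 ≠ 0 := Nat.cast_add_one_ne_zero n
  have h3 := hb.add_ne_zero n
  simp only [map_add, coeff_C_mul, coeff_X_mul_derivative,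
    coeff_derivative, coeff_kummerSeries_succ a hb]
  field_simp
  ring

theorem summable_norm_kummerSeries (a : ℂ) {b : ℂ} (hb : NotNonposInt b) (x : ℂ) :
    Summable fun n => ‖coeff n (kummerSeries a b) * x ^ n‖ := by
  have hlim : Filter.Tendsto (fun n : ℕ => (a + 1 * n) / (b + 1 * n) * (x * (1 / ((n : ℂ) + 1))))
      Filter.atTop (nhds (1 / 1 * (x * 0))) :=
    (tendsto_add_mul_div_add_mul_atTop_nhds a b 1 one_ne_zero).mul
      (tendsto_one_div_add_atTop_nhds_zero_nat.const_mul x)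
  have hlim' := hlim.norm
  simp only [mul_zero, norm_zero] at hlim'
  refine summable_of_ratio_norm_eventually_le (r := 1 / 2) (by norm_num) ?_
  filter_upwards [hlim'.eventually_le_const (show (0 : ℝ) < 1 / 2 by norm_num)] with n hn
  rw [norm_norm, norm_norm, coeff_kummerSeries_succ a hb,
    show (a + n) / ((b + n) * (n + 1)) * coeff n (kummerSeries a b) * x ^ (n + 1) =
      (a + 1 * n) / (b + 1 * n) * (x * (1 / ((n : ℂ) + 1))) *
        (coeff n (kummerSeries a b) * x ^ n) by
      rw [pow_succ, one_mul, div_mul_eq_div_div]; ring, norm_mul]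
  exact mul_le_mul_of_nonneg_right hn (norm_nonneg _)

theorem pFq_one_one (a b x : ℂ) :
    pFq [a] [b] x = ∑' n, coeff n (kummerSeries a b) * x ^ n := by
  refine tsum_congr fun n => ?_
  simp only [kummerSeries, coeff_mk, List.map_cons, List.map_nil, List.prod_cons, List.prod_nil,
    mul_one]
  ring

/-- The even coefficients of the square of `e^{-X/2} ₁F₁(α; 2α; X)`. -/
theorem coeff_even_sq_rescale_exp_mul_kummerSeries {α : ℂ} (h1 : NotNonposInt (2 * α))
    (h2 : NotNonposInt (α + 1 / 2)) (m : ℕ) :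
    coeff (2 * m) ((rescale (-1 / 2) (exp ℂ) * kummerSeries α (2 * α)) *
      (rescale (-1 / 2) (exp ℂ) * kummerSeries α (2 * α))) =
      poch α m / (poch (α + 1 / 2) m * poch (2 * α) m) / 4 ^ m / m.factorial := by
  induction m with
  | zero =>
    have hK : constantCoeff (kummerSeries α (2 * α)) = 1 := by
      rw [← coeff_zero_eq_constantCoeff_apply, kummerSeries, coeff_mk, poch_zero, poch_zero,
        Nat.factorial_zero]
      norm_num
    have hD : constantCoeff (rescale (-1 / 2 : ℂ) (exp ℂ)) = 1 := by
      rw [← coeff_zero_eq_constantCoeff_apply, coeff_rescale, coeff_exp]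
      simp
    rw [mul_zero, coeff_zero_eq_constantCoeff_apply, map_mul, map_mul, hK, hD]
    simp [poch_zero]
  | succ m ih =>
    have h := coeff_even_succ_sq_of_bessel (bessel_of_kummer (kummerSeries_ode α h1)) m
    rw [ih] at h
    have e1 : (m : ℂ) + 1 ≠ 0 := Nat.cast_add_one_ne_zero m
    have e2 : (m.factorial : ℂ) ≠ 0 := Nat.cast_ne_zero.mpr m.factorial_ne_zero
    have e3 : (m : ℂ) + 2 * α ≠ 0 := by rw [add_comm]; exact h1.add_ne_zero m
    have e4 : (m : ℂ) + (α + 1 / 2) ≠ 0 := by rw [add_comm]; exact h2.add_ne_zero m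
    have e5 := poch_ne_zero h1 m
    have e6 := poch_ne_zero h2 m
    refine mul_left_cancel₀ (mul_ne_zero (show (4 : ℂ) ≠ 0 by norm_num)
      (mul_ne_zero (mul_ne_zero e3 e1) e4)) (h.trans ?_)
    rw [poch_succ, poch_succ, poch_succ, Nat.factorial_succ, add_comm (2 * α) (m : ℂ),
      add_comm (α + 1 / 2) (m : ℂ)]
    push_cast
    generalize (m : ℂ) + 2 * α = u at *
    generalize (m : ℂ) + (α + 1 / 2) = v at *
    generalize poch (α + 1 / 2) m = p at *
    generalize poch (2 * α) m = q at *
    field_simp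
    ring

theorem preece_identity_exp_form (x α : ℂ)
    (h1 : NotNonposInt (2*α)) (h2 : NotNonposInt (α + 1/2)) :
    (pFq [α] [2*α] x) ^ 2 = Complex.exp x * pFq [α] [α + 1/2, 2*α] (x^2/4) := by
  have hodd := coeff_odd_mul_self
    (coeff_odd_of_bessel h1 (bessel_of_kummer (kummerSeries_ode α h1)))
  have heven := coeff_even_sq_rescale_exp_mul_kummerSeries h1 h2
  obtain ⟨hs, ht⟩ := tsum_coeff_mul_pow (summable_norm_rescale_exp (-1 / 2) x)
    (summable_norm_kummerSeries α h1 x)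
  have hY := (tsum_coeff_mul_pow hs hs).2
  rw [ht, tsum_rescale_exp, ← pFq_one_one] at hY
  have hG : ∑' n, coeff n ((rescale (-1 / 2) (exp ℂ) * kummerSeries α (2 * α)) *
      (rescale (-1 / 2) (exp ℂ) * kummerSeries α (2 * α))) * x ^ n =
      pFq [α] [α + 1 / 2, 2 * α] (x ^ 2 / 4) := by
    have hinj : Function.Injective fun m : ℕ => 2 * m := fun a b h => by simpa using h
    rw [← hinj.tsum_eq]
    · refine tsum_congr fun m => ?_
      simp only [heven, List.map_cons, List.map_nil, List.prod_cons, List.prod_nil, mul_one,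
        div_pow, ← pow_mul]
      ring
    · intro n hn
      rcases Nat.even_or_odd' n with ⟨j, rfl | rfl⟩
      · exact ⟨j, rfl⟩
      · exact absurd (mul_eq_zero_of_left (hodd j) _) hn
  rw [← hG, hY]
  have hexp : Complex.exp x * (Complex.exp (-1 / 2 * x) * Complex.exp (-1 / 2 * x)) = 1 := by
    rw [← Complex.exp_add, ← Complex.exp_add, Complex.exp_eq_one_iff]
    exact ⟨0, by push_cast; ring⟩
  linear_combination -(pFq [α] [2 * α] x) ^ 2 * hexp
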